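/- arXiv:2112.13228 — 4 statements merged into one kernel-verified Lean document; each statement's English description precedes it below -/
import Mathlib

section
/- Let N ≥ 2 and K ≥ 1, let B be a real N×K matrix with first row b₁ᵀ, and let B̃ be the (N−1)×K matrix obtained by deleting the first row of B. If rank(B̃) = K, then there exists a vector γ ∈ ℝᴺ whose first component equals 1 and which satisfies Bᵀγ = 0; consequently, for any vectors a ∈ ℝᴺ, f ∈ ℝᴷ and u ∈ ℝᴺ, if y = a + B f + u then the first coordinate of y satisfies y₁ = γᵀa − Σ_{j=2}^{N} γⱼ yⱼ + γᵀu, i.e. y₁ is an exact affine function of the remaining coordinates of y plus the error γᵀu, with coefficients not depending on f. -/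
open Matrix BigOperators

theorem hcw_aux (N K : ℕ) (z : Fin N)
    (B : Matrix (Fin N) (Fin K) ℝ)
    (Btilde : Matrix {i : Fin N // i ≠ z} (Fin K) ℝ)
    (hBtilde : ∀ (i : {i : Fin N // i ≠ z}) (j : Fin K), Btilde i j = B i.1 j)
    (hrank : Btilde.rank = K) :
    ∃ γ : Fin N → ℝ,
      γ z = 1 ∧
      Bᵀ.mulVec γ = 0 ∧
      ∀ (a : Fin N → ℝ) (f : Fin K → ℝ) (u y : Fin N → ℝ),
        y = a + B.mulVec f + u →
        y z =
          (∑ i, γ i * a i)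
            - (∑ i ∈ Finset.univ.erase z, γ i * y i)
            + ∑ i, γ i * u i := by
  have hsurj : Function.Surjective (Btildeᵀ).mulVecLin := by
    rw [← LinearMap.range_eq_top]
    apply Submodule.eq_top_of_finrank_eq
    have h : (Btildeᵀ).rank = K := by rw [Matrix.rank_transpose]; exact hrank
    rw [Matrix.rank] at h
    rw [h]
    simp
  obtain ⟨δ, hδ⟩ := hsurj (fun j => - B z j)
  let γ : Fin N → ℝ := fun i => if h : i = z then 1 else δ ⟨i, h⟩
  have hγ0 : γ z = 1 := by simp [γ]
  have hγ : Bᵀ.mulVec γ = 0 := by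
    funext j
    have h1 := congrFun hδ j
    simp only [Matrix.mulVecLin_apply, Matrix.mulVec, dotProduct, Matrix.transpose_apply] at h1
    simp only [Matrix.mulVec, dotProduct, Matrix.transpose_apply, Pi.zero_apply]
    rw [← Finset.add_sum_erase _ _ (Finset.mem_univ z), hγ0]
    rw [Finset.sum_subtype (p := fun i => i ≠ z) (Finset.univ.erase z) (by simp)]
    have h2 : ∀ i : {i : Fin N // i ≠ z}, B i.1 j * γ i.1 = Btilde i j * δ i := by
      intro i
      rw [hBtilde]
      simp [γ, i.2]
    rw [Finset.sum_congr rfl (fun i _ => h2 i), h1]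
    ring
  refine ⟨γ, hγ0, hγ, ?_⟩
  intro a f u y hy
  have h3 : ∑ i, γ i * (B.mulVec f) i = 0 := by
    have : γ ⬝ᵥ (B.mulVec f) = 0 := by
      rw [Matrix.dotProduct_mulVec, ← Matrix.mulVec_transpose, hγ, zero_dotProduct]
    exact this
  have h4 : ∑ i, γ i * y i = ∑ i, γ i * a i + ∑ i, γ i * u i := by
    subst hy
    simp only [Pi.add_apply, mul_add, Finset.sum_add_distrib, h3]
    ring
  rw [← Finset.add_sum_erase _ _ (Finset.mem_univ z), hγ0] at h4
  linarith

/-- If the matrix `B̃` obtained from the `N × K` matrix `B` by deleting its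
first row has rank `K`, then there is a vector `γ ∈ ℝᴺ` with first component `1` and
`Bᵀ γ = 0`; consequently, for any `a, u ∈ ℝᴺ`, `f ∈ ℝᴷ`, if `y = a + B f + u` then
`y₁ = γᵀa − Σ_{j≠1} γⱼ yⱼ + γᵀu`. -/
theorem hcw_factor_elimination (N K : ℕ) (hN : 2 ≤ N) (hK : 1 ≤ K)
    (B : Matrix (Fin N) (Fin K) ℝ)
    (Btilde : Matrix {i : Fin N // i ≠ ⟨0, by omega⟩} (Fin K) ℝ)
    (hBtilde : ∀ (i : {i : Fin N // i ≠ ⟨0, by omega⟩}) (j : Fin K), Btilde i j = B i.1 j)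
    (hrank : Btilde.rank = K) :
    ∃ γ : Fin N → ℝ,
      γ ⟨0, by omega⟩ = 1 ∧
      Bᵀ.mulVec γ = 0 ∧
      ∀ (a : Fin N → ℝ) (f : Fin K → ℝ) (u y : Fin N → ℝ),
        y = a + B.mulVec f + u →
        y ⟨0, by omega⟩ =
          (∑ i, γ i * a i)
            - (∑ i ∈ Finset.univ.erase (⟨0, by omega⟩ : Fin N), γ i * y i)
            + ∑ i, γ i * u i := by
  exact hcw_aux N K ⟨0, by omega⟩ B Btilde hBtilde hrank
end

section
/- Let φ(s) = (2π)^{−1/2} exp(−s²/2). For every α > 0, [ ∫_ℝ s² φ(s)^{1+2α} ds − ( ∫_ℝ s φ(s)^{1+α} ds )² ] / ( ∫_ℝ s² φ(s)^{1+α} ds )² = (1 + α²/(1+2α))^{3/2}. -/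
open MeasureTheory Real

lemma aux_sq (c : ℝ) (hc : 0 < c) :
    ∫ s : ℝ, s ^ 2 * ((2 * Real.pi) ^ (-(1 / 2 : ℝ)) * Real.exp (-s ^ 2 / 2)) ^ c
      = (2 * Real.pi) ^ ((1 - c) / 2) * c ^ (-(3 / 2 : ℝ)) := by
  have h2 : (0 : ℝ) < 2 * Real.pi := by positivity
  obtain ⟨v, hvc⟩ : ∃ v : NNReal, (v : ℝ) = c⁻¹ :=
    ⟨Real.toNNReal c⁻¹, Real.coe_toNNReal _ (by positivity)⟩
  have hv : v ≠ 0 := by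
    rintro rfl
    have : (0 : ℝ) < c⁻¹ := by positivity
    simp [← hvc] at this
  have h1 := ProbabilityTheory.variance_fun_id_gaussianReal (μ := 0) (v := v)
  rw [ProbabilityTheory.variance_eq_integral (by fun_prop),
    ProbabilityTheory.integral_id_gaussianReal,
    ProbabilityTheory.integral_gaussianReal_eq_integral_smul hv] at h1
  simp only [ProbabilityTheory.gaussianPDFReal, hvc, sub_zero, smul_eq_mul] at h1
  have e : ∀ s : ℝ, s ^ 2 * ((2 * Real.pi) ^ (-(1 / 2 : ℝ)) * Real.exp (-s ^ 2 / 2)) ^ c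
      = ((2 * Real.pi) ^ (-(c / 2)) * √(2 * π * c⁻¹)) *
        ((√(2 * π * c⁻¹))⁻¹ * rexp (-s ^ 2 / (2 * c⁻¹)) * s ^ 2) := by
    intro s
    have hs : √(2 * π * c⁻¹) ≠ 0 := by positivity
    rw [Real.mul_rpow (by positivity) (by positivity), ← Real.rpow_mul h2.le, ← Real.exp_mul]
    have a : -(1 / 2 : ℝ) * c = -(c / 2) := by ring
    have b : -s ^ 2 / 2 * c = -s ^ 2 / (2 * c⁻¹) := by field_simp
    rw [a, b]
    field_simp
  simp_rw [e]
  rw [integral_const_mul, h1, Real.sqrt_eq_rpow, Real.mul_rpow h2.le (by positivity),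
    ← Real.rpow_neg_one c, ← Real.rpow_mul hc.le]
  have : (1 - c) / 2 = -(c / 2) + 1 / 2 := by ring
  have h3 : (-(3 / 2) : ℝ) = -1 * (1 / 2) + -1 := by norm_num
  rw [this, h3, Real.rpow_add h2, Real.rpow_add hc]
  ring

/-- For the standard normal density `φ` and every `α > 0`,
`[∫ s² φ^{1+2α} − (∫ s φ^{1+α})²] / (∫ s² φ^{1+α})² = (1 + α²/(1+2α))^{3/2}`,
the closed form of the asymptotic variance factor `v_β(α)` under normal errors. -/
theorem v_beta_closed_form (α : ℝ) (hα : 0 < α)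
    (φ : ℝ → ℝ) (hφ : ∀ s, φ s = (2 * Real.pi) ^ (-(1 / 2 : ℝ)) * Real.exp (-s ^ 2 / 2)) :
    ((∫ s : ℝ, s ^ 2 * φ s ^ (1 + 2 * α)) - (∫ s : ℝ, s * φ s ^ (1 + α)) ^ 2)
        / (∫ s : ℝ, s ^ 2 * φ s ^ (1 + α)) ^ 2
      = (1 + α ^ 2 / (1 + 2 * α)) ^ ((3 : ℝ) / 2) := by
  have h2 : (0 : ℝ) < 2 * Real.pi := by positivity
  have h0 : ∫ s : ℝ, s * φ s ^ (1 + α) = 0 := by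
    have h := integral_neg_eq_self (fun s : ℝ => s * φ s ^ (1 + α)) volume
    have e : ∀ s : ℝ, -s * φ (-s) ^ (1 + α) = -(s * φ s ^ (1 + α)) := by
      intro s
      rw [hφ, hφ, neg_sq]
      ring
    simp_rw [e] at h
    rw [integral_neg] at h
    linarith
  rw [h0, zero_pow two_ne_zero, sub_zero]
  simp_rw [hφ]
  rw [aux_sq _ (by positivity), aux_sq _ (by positivity)]
  have hb : 1 + α ^ 2 / (1 + 2 * α) = (1 + α) ^ 2 / (1 + 2 * α) := by field_simp; ring
  rw [hb, Real.div_rpow (by positivity) (by positivity), mul_pow,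
    ← Real.rpow_natCast, ← Real.rpow_natCast, ← Real.rpow_natCast, ← Real.rpow_mul h2.le,
    ← Real.rpow_mul (by positivity), ← Real.rpow_mul (by positivity)]
  have a1 : (1 - (1 + α)) / 2 * ((2 : ℕ) : ℝ) = (1 - (1 + 2 * α)) / 2 := by push_cast; ring
  have a2 : -(3 / 2 : ℝ) * ((2 : ℕ) : ℝ) = -3 := by norm_num
  have a3 : ((2 : ℕ) : ℝ) * (3 / 2 : ℝ) = 3 := by norm_num
  rw [a1, a2, a3, Real.rpow_neg (by positivity), Real.rpow_neg (by positivity)]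
  have p1 : (2 * π) ^ ((1 - (1 + 2 * α)) / 2) ≠ 0 := by positivity
  generalize (2 * π) ^ ((1 - (1 + 2 * α)) / 2) = A at *
  have p2 : (1 + 2 * α) ^ (3 / 2 : ℝ) ≠ 0 := by positivity
  have p3 : (1 + α) ^ (3 : ℝ) ≠ 0 := by positivity
  generalize (1 + 2 * α) ^ (3 / 2 : ℝ) = B at *
  generalize (1 + α) ^ (3 : ℝ) = C at *
  field_simp
end

section
/- Let φ(s) = (2π)^{−1/2} exp(−s²/2) and u(s) = −s, and for β > 0 set ζ_{22,β} = [∫ s² u(s)² φ^{1+β} + 2 ∫ s u(s) φ^{1+β} + ∫ φ^{1+β}]/4 and φ_{2,β} = −[∫ φ^{1+β} + ∫ s u(s) φ^{1+β}]/2. Then for every α > 0, [ζ_{22,2α} − φ_{2,α}²] / ζ_{22,α}² = (4/(α²+2)²) [ 2(1+2α²)(1 + α²/(1+2α))^{5/2} − α²(1+α)² ]. -/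
open MeasureTheory Real

lemma aux_mom (k : ℕ) {b : ℝ} (hb : 0 < b) :
    ∫ x : ℝ, x ^ (2 * k) * Real.exp (-b * x ^ 2)
      = b ^ (-((2 * k : ℕ) + 1 : ℝ) / 2) * Real.Gamma (((2 * k : ℕ) + 1 : ℝ) / 2) := by
  have h1 : ∀ x : ℝ, x ^ (2 * k) * Real.exp (-b * x ^ 2)
      = (fun y : ℝ => y ^ (2 * k) * Real.exp (-b * y ^ 2)) |x| := by
    intro x
    simp only [pow_mul, sq_abs]
  rw [integral_congr_ae (Filter.Eventually.of_forall h1)]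
  rw [integral_comp_abs (f := fun y : ℝ => y ^ (2 * k) * Real.exp (-b * y ^ 2))]
  have h2 := integral_rpow_mul_exp_neg_mul_rpow (p := 2) (q := ((2 * k : ℕ) : ℝ)) (b := b)
    (by norm_num) (lt_of_lt_of_le (by norm_num) (Nat.cast_nonneg _)) hb
  have h3 : ∫ x in Set.Ioi (0 : ℝ), x ^ (2 * k) * Real.exp (-b * x ^ 2)
      = ∫ x in Set.Ioi (0 : ℝ), x ^ ((2 * k : ℕ) : ℝ) * Real.exp (-b * x ^ (2 : ℝ)) := by
    refine integral_congr_ae (Filter.Eventually.of_forall fun x => ?_)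
    simp only [Real.rpow_natCast, Real.rpow_two]
  rw [h3, h2]
  ring

lemma aux_mom2 {b : ℝ} (hb : 0 < b) :
    ∫ x : ℝ, x ^ 2 * Real.exp (-b * x ^ 2) = (∫ x : ℝ, Real.exp (-b * x ^ 2)) / (2 * b) := by
  have h0 := aux_mom 0 hb
  have h1 := aux_mom 1 hb
  norm_num at h0 h1
  have hg : Real.Gamma (3 / 2) = 1 / 2 * √π := by
    rw [← Real.Gamma_one_half_eq, ← Real.Gamma_add_one (by norm_num)]; norm_num
  have hp : b ^ (-(3 / 2) : ℝ) = b ^ (-(1 / 2) : ℝ) / b := by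
    rw [← Real.rpow_sub_one hb.ne']; norm_num

  simp only [neg_mul]
  rw [h1, h0, hg, hp, ← Real.Gamma_one_half_eq]
  norm_num
  field_simp

lemma aux_mom4 {b : ℝ} (hb : 0 < b) :
    ∫ x : ℝ, x ^ 4 * Real.exp (-b * x ^ 2)
      = 3 * (∫ x : ℝ, Real.exp (-b * x ^ 2)) / (2 * b) ^ 2 := by
  have h0 := aux_mom 1 hb
  have h1 := aux_mom 2 hb
  norm_num at h0 h1
  have hg : Real.Gamma (5 / 2) = 3 / 2 * Real.Gamma (3 / 2) := by
    rw [← Real.Gamma_add_one (by norm_num)]; norm_num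
  have hp : b ^ (-(5 / 2) : ℝ) = b ^ (-(3 / 2) : ℝ) / b := by
    rw [← Real.rpow_sub_one hb.ne']; norm_num
  have h2 := aux_mom2 hb
  simp only [neg_mul] at h2 ⊢
  have h3 : ∫ x : ℝ, Real.exp (-(b * x ^ 2)) = 2 * b * ∫ x : ℝ, x ^ 2 * Real.exp (-(b * x ^ 2)) := by
    rw [h2]; field_simp
  rw [h3, h1, h0, hg, hp]
  field_simp

lemma aux_pow (s t : ℝ) :
    ((2 * Real.pi) ^ (-(1 / 2 : ℝ)) * Real.exp (-s ^ 2 / 2)) ^ t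
      = (2 * Real.pi) ^ (-(t / 2)) * Real.exp (-(t / 2) * s ^ 2) := by
  rw [Real.mul_rpow (by positivity) (by positivity), ← Real.rpow_mul (by positivity),
    ← Real.exp_mul]
  congr 2 <;> ring

/-- Closed form of the asymptotic variance factor `v_σ(α)` of the MDPDE of
the error variance under normal errors: for every `α > 0`,
`[ζ_{22,2α} − φ_{2,α}²]/ζ_{22,α}² = (4/(α²+2)²)[2(1+2α²)(1+α²/(1+2α))^{5/2} − α²(1+α)²]`. -/
theorem v_sigma_closed_form
    (φ : ℝ → ℝ) (hφ : ∀ s, φ s = (2 * Real.pi) ^ (-(1 / 2 : ℝ)) * Real.exp (-s ^ 2 / 2))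
    (u : ℝ → ℝ) (hu : ∀ s, u s = -s)
    (ζ22 φ2 : ℝ → ℝ)
    (hζ22 : ∀ β : ℝ, 0 < β → ζ22 β =
      ((∫ s : ℝ, s ^ 2 * u s ^ 2 * φ s ^ (1 + β))
          + 2 * (∫ s : ℝ, s * u s * φ s ^ (1 + β))
          + (∫ s : ℝ, φ s ^ (1 + β))) / 4)
    (hφ2 : ∀ β : ℝ, 0 < β → φ2 β =
      -(((∫ s : ℝ, φ s ^ (1 + β)) + (∫ s : ℝ, s * u s * φ s ^ (1 + β))) / 2)) :
    ∀ α : ℝ, 0 < α →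
      (ζ22 (2 * α) - φ2 α ^ 2) / ζ22 α ^ 2
        = (4 / (α ^ 2 + 2) ^ 2) *
            (2 * (1 + 2 * α ^ 2) * (1 + α ^ 2 / (1 + 2 * α)) ^ ((5 : ℝ) / 2)
              - α ^ 2 * (1 + α) ^ 2) := by
  have key : ∀ β : ℝ, 0 < β → ∃ J : ℝ, J = (2 * π) ^ (-((1 + β) / 2)) * √(2 * π / (1 + β)) ∧
      ζ22 β = J * (β ^ 2 + 2) / (4 * (1 + β) ^ 2) ∧ φ2 β = -(J * β / (2 * (1 + β))) := by
    intro β hβ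
    have hb : 0 < (1 + β) / 2 := by positivity
    have i0 : ∫ s : ℝ, φ s ^ (1 + β) = (2 * π) ^ (-((1 + β) / 2)) * √(2 * π / (1 + β)) := by
      simp_rw [hφ, aux_pow]
      rw [integral_const_mul, integral_gaussian]
      congr 2
      field_simp
    have i2 : ∫ s : ℝ, s * u s * φ s ^ (1 + β) = -((∫ s : ℝ, φ s ^ (1 + β)) / (1 + β)) := by
      simp_rw [hφ, aux_pow, hu]
      have : ∀ s : ℝ, s * -s * ((2 * π) ^ (-((1 + β) / 2)) * Real.exp (-((1 + β) / 2) * s ^ 2))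
          = -(2 * π) ^ (-((1 + β) / 2)) * (s ^ 2 * Real.exp (-((1 + β) / 2) * s ^ 2)) := by
        intro s; ring
      simp_rw [this]
      rw [integral_const_mul, integral_const_mul, aux_mom2 hb]
      field_simp
    have i4 : ∫ s : ℝ, s ^ 2 * u s ^ 2 * φ s ^ (1 + β)
        = 3 * (∫ s : ℝ, φ s ^ (1 + β)) / (1 + β) ^ 2 := by
      simp_rw [hφ, aux_pow, hu]
      have : ∀ s : ℝ, s ^ 2 * (-s) ^ 2 *
          ((2 * π) ^ (-((1 + β) / 2)) * Real.exp (-((1 + β) / 2) * s ^ 2))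
          = (2 * π) ^ (-((1 + β) / 2)) * (s ^ 4 * Real.exp (-((1 + β) / 2) * s ^ 2)) := by
        intro s; ring
      simp_rw [this]
      rw [integral_const_mul, integral_const_mul, aux_mom4 hb]
      field_simp
    refine ⟨_, rfl, ?_, ?_⟩
    · rw [hζ22 β hβ, i4, i2, i0]
      field_simp
      ring
    · rw [hφ2 β hβ, i2, i0]
      field_simp
      ring
  intro α hα
  obtain ⟨J, hJ, hz, hp⟩ := key α hα
  obtain ⟨K, hK, hz2, -⟩ := key (2 * α) (by positivity)
  have hP : (0 : ℝ) < 2 * π := by positivity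
  obtain ⟨c, hc⟩ : ∃ c, c = (2 * π) ^ (-α) := ⟨_, rfl⟩
  have hc0 : 0 < c := by rw [hc]; positivity
  obtain ⟨w, hw⟩ : ∃ w, w = √(1 + 2 * α) := ⟨_, rfl⟩
  have hw0 : 0 < w := by rw [hw]; positivity
  have hw2 : w ^ 2 = 1 + 2 * α := by rw [hw]; exact Real.sq_sqrt (by positivity)
  have hK' : K = c / w := by
    rw [hK, hc, hw, Real.sqrt_div hP.le, Real.sqrt_eq_rpow (2 * π), ← mul_div_assoc,
      ← Real.rpow_add hP]
    congr 2; ring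
  have hJ' : J ^ 2 = c / (1 + α) := by
    rw [hJ, hc, mul_pow, Real.sq_sqrt (by positivity), ← Real.rpow_natCast, ← Real.rpow_mul hP.le,
      ← mul_div_assoc, ← Real.rpow_add_one hP.ne']
    congr 2; push_cast; ring
  have hr : (1 + α ^ 2 / (1 + 2 * α)) ^ ((5 : ℝ) / 2) = (1 + α) ^ 5 / w ^ 5 := by
    have : 1 + α ^ 2 / (1 + 2 * α) = ((1 + α) / w) ^ (2 : ℝ) := by
      rw [Real.rpow_two, div_pow, hw2]; field_simp; ring
    rw [this, ← Real.rpow_mul (by positivity), ← div_pow, ← Real.rpow_natCast]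
    norm_num
  have e1 : φ2 α ^ 2 = c * α ^ 2 / (4 * (1 + α) ^ 3) := by
    rw [hp, neg_sq, div_pow, mul_pow, hJ']; field_simp; norm_num
  have e2 : ζ22 α ^ 2 = c * (α ^ 2 + 2) ^ 2 / (16 * (1 + α) ^ 5) := by
    rw [hz, div_pow, mul_pow, hJ']; field_simp; norm_num
  have e3 : ζ22 (2 * α) = c * (2 * α ^ 2 + 1) / (2 * w ^ 5) := by
    rw [hz2, hK', ← hw2]; field_simp; ring
  rw [hr, e1, e2, e3]
  field_simp
  ring
end

section
/- Let α > 0, σ > 0, b ∈ ℝ, N ≥ 1 and x ∈ ℝᴺ. Let f : ℝ → (0, ∞) be a differentiable probability density with u = f′/f, and assume the integrals M_{f,i,j}^{(α)} = ∫ sⁱ u(s)ʲ f(s)^{1+α} ds are finite for 0 ≤ i, j ≤ 2. Define the density f_*(y) = σ^{−1} f((y−b)/σ) and the score vector v(y) = −( u((y−b)/σ) x/σ ; 1/(2σ²) + u((y−b)/σ)(y−b)/(2σ³) ) ∈ ℝ^{N+1}. Then: (i) ∫_ℝ v(y) v(y)ᵀ f_*(y)^{1+α} dy = σ^{−(α+2)}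 [[ ζ₁₁ x xᵀ , (ζ₁₂/σ) x ], [ (ζ₁₂/σ) xᵀ , ζ₂₂/σ² ]], where ζ₁₁ = M_{f,0,2}^{(α)}, ζ₁₂ = [M_{f,0,1}^{(α)} + M_{f,1,2}^{(α)}]/2 and ζ₂₂ = [M_{f,2,2}^{(α)} + 2M_{f,1,1}^{(α)} + M_{f,0,0}^{(α)}]/4; and (ii) ∫_ℝ v(y) f_*(y)^{1+α} dy = ( σ^{−(α+1)} φ₁ x ; σ^{−(α+2)} φ₂ ), where φ₁ = −M_{f,0,1}^{(α)} and φ₂ = −[M_{f,0,0}^{(α)} + M_{f,1,1}^{(α)}]/2. -/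
open MeasureTheory Matrix BigOperators

/-- The score integrals of the proof of Theorem 3.1: with
`f_*(y) = σ^{−1} f((y−b)/σ)` and the score vector `v`, one has
`∫ v vᵀ f_*^{1+α} = σ^{−(α+2)} [[ζ₁₁ x xᵀ, (ζ₁₂/σ)x], [(ζ₁₂/σ)xᵀ, ζ₂₂/σ²]]` and
`∫ v f_*^{1+α} = (σ^{−(α+1)} φ₁ x ; σ^{−(α+2)} φ₂)`, where the `ζ`'s and `φ`'s are the
stated combinations of the moments `M_{f,i,j}^{(α)} = ∫ sⁱ u(s)ʲ f(s)^{1+α} ds`. -/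
theorem score_moment_integrals (N : ℕ) (hN : 1 ≤ N) (α : ℝ) (hα : 0 < α)
    (σ : ℝ) (hσ : 0 < σ) (b : ℝ) (x : Fin N → ℝ)
    (f : ℝ → ℝ) (hf_pos : ∀ s, 0 < f s) (hf_diff : Differentiable ℝ f)
    (hf_prob : (∫ s : ℝ, f s) = 1)
    (u : ℝ → ℝ) (hu : ∀ s, u s = deriv f s / f s)
    (hint : ∀ i j : ℕ, i ≤ 2 → j ≤ 2 →
      Integrable (fun s : ℝ => s ^ i * u s ^ j * f s ^ (1 + α)))
    (M : ℕ → ℕ → ℝ)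
    (hM : ∀ i j : ℕ, M i j = ∫ s : ℝ, s ^ i * u s ^ j * f s ^ (1 + α))
    (fstar : ℝ → ℝ) (hfstar : ∀ y, fstar y = σ⁻¹ * f ((y - b) / σ))
    (v : ℝ → (Fin N ⊕ Unit) → ℝ)
    (hv1 : ∀ (y : ℝ) (i : Fin N), v y (Sum.inl i) = -(u ((y - b) / σ) * x i / σ))
    (hv2 : ∀ y : ℝ,
      v y (Sum.inr ()) = -(1 / (2 * σ ^ 2) + u ((y - b) / σ) * (y - b) / (2 * σ ^ 3))) :
    (∀ i j : Fin N ⊕ Unit,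
      (∫ y : ℝ, v y i * v y j * fstar y ^ (1 + α))
        = σ ^ (-(α + 2)) *
            (Matrix.fromBlocks
              (Matrix.of fun a a' => M 0 2 * x a * x a')
              (Matrix.of fun a _ => (((M 0 1 + M 1 2) / 2) / σ) * x a)
              (Matrix.of fun _ a' => (((M 0 1 + M 1 2) / 2) / σ) * x a')
              (Matrix.of fun _ _ =>
                ((M 2 2 + 2 * M 1 1 + M 0 0) / 4) / σ ^ 2)) i j) ∧
    (∀ i : Fin N,
      (∫ y : ℝ, v y (Sum.inl i) * fstar y ^ (1 + α))
        = σ ^ (-(α + 1)) * (-(M 0 1)) * x i) ∧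
    ((∫ y : ℝ, v y (Sum.inr ()) * fstar y ^ (1 + α))
        = σ ^ (-(α + 2)) * (-((M 0 0 + M 1 1) / 2))) := by
  have hσ0 : σ ≠ 0 := hσ.ne'
  have hK1 : σ ^ (-(α + 1)) = σ ^ (-(α + 2)) * σ := by
    rw [← Real.rpow_add_one hσ0]; congr 1; ring
  have hfs : ∀ y, fstar y ^ (1 + α)
      = σ ^ (-(α + 2)) * σ * f ((y - b) / σ) ^ (1 + α) := by
    intro y
    rw [hfstar, Real.mul_rpow (inv_nonneg.2 hσ.le) (hf_pos _).le, Real.inv_rpow hσ.le,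
      ← Real.rpow_neg hσ.le, ← hK1, add_comm 1 α]
  rw [hK1]
  generalize σ ^ (-(α + 2)) = K at *
  have key : ∀ (F g : ℝ → ℝ) (c : ℝ), (∀ s, F (σ * s + b) = c * g s) →
      (∫ y, F y) = c * σ * ∫ s, g s := by
    intro F g c h
    have h1 : ∀ y, F y = c * g ((y - b) / σ) := by
      intro y
      rw [← h]; congr 1; field_simp; ring
    simp_rw [h1]
    rw [integral_const_mul, integral_sub_right_eq_self (fun y => g (y / σ)) b,
      Measure.integral_comp_div, abs_of_pos hσ, smul_eq_mul, mul_assoc]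
  have hsb : ∀ s, (σ * s + b - b) / σ = s := by intro s; field_simp; ring
  have hsb2 : ∀ s, σ * s + b - b = σ * s := by intro s; ring
  have h00 := hint 0 0 (by norm_num) (by norm_num)
  have h01 := hint 0 1 (by norm_num) (by norm_num)
  have h11 := hint 1 1 (by norm_num) (by norm_num)
  have h12 := hint 1 2 (by norm_num) (by norm_num)
  have h22 := hint 2 2 (by norm_num) (by norm_num)
  have h3 : Integrable (fun s => s ^ 2 * u s ^ 2 * f s ^ (1 + α)
      + 2 * (s ^ 1 * u s ^ 1 * f s ^ (1 + α))) := h22.add (h11.const_mul 2)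
  have hoff : ∀ a : Fin N, (∫ y : ℝ, v y (Sum.inl a) * v y (Sum.inr ()) * fstar y ^ (1 + α))
      = K * ((((M 0 1 + M 1 2) / 2) / σ) * x a) := by
    intro a
    rw [key _ (fun s => s ^ 0 * u s ^ 1 * f s ^ (1 + α) + s ^ 1 * u s ^ 2 * f s ^ (1 + α))
      (K * x a / (2 * σ ^ 2)), integral_add h01 h12, ← hM, ← hM]
    · field_simp
    · intro s
      simp only [hv1, hv2, hfs, hsb, hsb2]
      field_simp
      try ring
  refine ⟨?_, ?_, ?_⟩
  · rintro (a | ⟨⟩) (a' | ⟨⟩)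
    · simp only [fromBlocks_apply₁₁, of_apply]
      rw [key _ (fun s => s ^ 0 * u s ^ 2 * f s ^ (1 + α)) (K * x a * x a' / σ), ← hM]
      · field_simp
      · intro s
        simp only [hv1, hfs, hsb]
        field_simp
        try ring
    · simp only [fromBlocks_apply₁₂, of_apply]
      exact hoff a
    · simp only [fromBlocks_apply₂₁, of_apply]
      rw [← hoff a']
      congr 1
      funext y
      ring
    · simp only [fromBlocks_apply₂₂, of_apply]
      rw [key _ (fun s => s ^ 2 * u s ^ 2 * f s ^ (1 + α)
          + 2 * (s ^ 1 * u s ^ 1 * f s ^ (1 + α)) + s ^ 0 * u s ^ 0 * f s ^ (1 + α))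
        (K / (4 * σ ^ 3)), integral_add h3 h00,
        integral_add h22 (h11.const_mul 2), integral_const_mul, ← hM, ← hM, ← hM]
      · field_simp
      · intro s
        simp only [hv2, hfs, hsb, hsb2]
        field_simp
        try ring
  · intro a
    rw [key _ (fun s => s ^ 0 * u s ^ 1 * f s ^ (1 + α)) (-(K * x a)), ← hM]
    · ring
    · intro s
      simp only [hv1, hfs, hsb]
      field_simp
      try ring
  · rw [key _ (fun s => s ^ 0 * u s ^ 0 * f s ^ (1 + α) + s ^ 1 * u s ^ 1 * f s ^ (1 + α))
      (-(K / (2 * σ))), integral_add h00 h11, ← hM, ← hM]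
    · field_simp
    · intro s
      simp only [hv2, hfs, hsb, hsb2]
      field_simp
      try ring
end
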